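/- Let w ≥ 1 be an integer and ε₀ ∈ [0, 1/4). Every decision tree T over {0,1}^{2^w · w} with dist(T, Tribes_w) ≤ ε₀ satisfies Σ_{i ∈ [2^w], j ∈ [w]} δ_{i,j}(T) ≥ (1/4 − ε₀)·2^w; that is, the expected number of coordinates queried by T on a uniformly random input is at least (1/4 − ε₀)·2^w. -/

import Mathlib

open Finset
open scoped Classical

noncomputable section

variable {ι : Type*} [Fintype ι] [DecidableEq ι]

/-- Probability of an event under the uniform distribution on `ι → Bool`. -/
def prU (p : (ι → Bool) → Prop) : ℝ :=
  ((Finset.univ.filter fun x => p x).card : ℝ) / (Fintype.card (ι → Bool) : ℝ)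

/-- Expectation of a real-valued function under the uniform distribution on `ι → Bool`. -/
def expU (g : (ι → Bool) → ℝ) : ℝ :=
  (∑ x : ι → Bool, g x) / (Fintype.card (ι → Bool) : ℝ)

/-- `Inf_i[f]`: the influence of coordinate `i` on `f`. -/
def influence (f : (ι → Bool) → Bool) (i : ι) : ℝ :=
  prU fun x => f x ≠ f (Function.update x i (!x i))

/-- `dist(f, g)`: probability that `f` and `g` disagree on a uniform random input. -/
def distU (f g : (ι → Bool) → Bool) : ℝ := prU fun x => f x ≠ g x

/-- `bias(f)`: the distance of `f` to the nearest constant function. -/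
def biasU (f : (ι → Bool) → Bool) : ℝ :=
  min (distU f fun _ => false) (distU f fun _ => true)

/-- The restriction `f_π` of `f` under the partial assignment `π`, viewed as a function
on the full cube (the fixed coordinates are irrelevant, so probabilities/influences over
the full cube agree with those over the unfixed coordinates). -/
def restrictB (f : (ι → Bool) → Bool) (π : ι → Option Bool) : (ι → Bool) → Bool :=
  fun x => f fun i => (π i).getD (x i)

/-- Decision trees over coordinate set `α`: internal nodes query a coordinate
(with a 0-child and a 1-child), leaves are labeled by bits. -/
inductive DTree (α : Type*) where
  | leaf : Bool → DTree α
  | node : α → DTree α → DTree α → DTree α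

namespace DTree

/-- The output of the decision tree on input `x`. -/
def eval : DTree ι → (ι → Bool) → Bool
  | leaf b, _ => b
  | node j t0 t1, x => if x j then eval t1 x else eval t0 x

/-- The computation path of the tree on input `x` queries coordinate `i`. -/
def Queries : DTree ι → (ι → Bool) → ι → Prop
  | leaf _, _, _ => False
  | node j t0 t1, x, i =>
      j = i ∨ (if x j then Queries t1 x i else Queries t0 x i)

end DTree

/-- `δ_i(T)`: probability that `T` queries coordinate `i` on a uniform random input. -/
def deltaU (T : DTree ι) (i : ι) : ℝ := prU fun x => T.Queries x i

/-- The Tribes function with `2^w` tribes of width `w`: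
`Tribes_w(x) = ⋁_{i ∈ [2^w]} ⋀_{j ∈ [w]} x_{i,j}`. -/
def tribes (w : ℕ) : (Fin (2 ^ w) × Fin w → Bool) → Bool :=
  fun x => decide (∃ i : Fin (2 ^ w), ∀ j : Fin w, x (i, j) = true)

lemma prU_eq_card_div (p : (ι → Bool) → Prop) [DecidablePred p] :
    prU p = ((Finset.univ.filter p).card : ℝ) / (Fintype.card (ι → Bool) : ℝ) := by
  unfold prU
  congr

lemma prU_eq_expU (p : (ι → Bool) → Prop) : prU p = expU fun x => if p x then 1 else 0 := by
  simp [prU, expU]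

lemma expU_mono {g h : (ι → Bool) → ℝ} (H : ∀ x, g x ≤ h x) : expU g ≤ expU h := by
  unfold expU
  gcongr with x
  exact H x

lemma expU_add (g h : (ι → Bool) → ℝ) : expU (fun x => g x + h x) = expU g + expU h := by
  simp [expU, Finset.sum_add_distrib, add_div]

lemma prU_false : prU (fun _ : ι → Bool => False) = 0 := by
  rw [prU_eq_card_div]
  simp

lemma prU_nonneg (p : (ι → Bool) → Prop) : 0 ≤ prU p := by
  unfold prU
  positivity

lemma prU_mono {p q : (ι → Bool) → Prop} (H : ∀ x, p x → q x) : prU p ≤ prU q := by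
  unfold prU
  gcongr with x
  exact H x

lemma prU_true : prU (fun _ : ι → Bool => True) = 1 := by
  simp [prU]

lemma prU_compl (p : (ι → Bool) → Prop) : prU (fun x => ¬ p x) = 1 - prU p := by
  rw [eq_sub_iff_add_eq, ← prU_true (ι := ι), prU_eq_expU, prU_eq_expU p, ← expU_add,
    prU_eq_expU fun _ => True]
  congr 1
  funext x
  by_cases h : p x <;> simp only [h, not_true_eq_false, not_false_eq_true, if_true, if_false] <;>
    norm_num

lemma prU_le_add {p q r : (ι → Bool) → Prop} (H : ∀ x, p x → q x ∨ r x) :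
    prU p ≤ prU q + prU r := by
  rw [prU_eq_expU, prU_eq_expU q, prU_eq_expU r, ← expU_add]
  refine expU_mono fun x => ?_
  have := H x
  by_cases hp : p x <;> by_cases hq : q x <;> by_cases hr : r x <;> simp_all

/-- Summing over both values of the coordinate `j` counts every point of the cube twice. -/
lemma sum_update_add_sum_update (j : ι) (g : (ι → Bool) → ℝ) :
    ∑ x, g (Function.update x j false) + ∑ x, g (Function.update x j true) = 2 * ∑ x, g x := by
  let flip : (ι → Bool) ≃ (ι → Bool) :=
    Function.Involutive.toPerm (fun x => Function.update x j (!x j)) fun x => by simp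
  have hflip : ∑ x, g (Function.update x j (!x j)) = ∑ x, g x := Equiv.sum_comp flip g
  rw [two_mul]
  nth_rewrite 1 [← hflip]
  rw [← Finset.sum_add_distrib, ← Finset.sum_add_distrib]
  refine Finset.sum_congr rfl fun x _ => ?_
  have hx := Function.update_eq_self j x
  cases h : x j <;> rw [h] at hx <;> simp [hx, add_comm]

lemma prU_eq_half_add_half (j : ι) (p : (ι → Bool) → Prop) :
    prU p = (prU (fun x => p (Function.update x j false)) +
      prU (fun x => p (Function.update x j true))) / 2 := by
  have := sum_update_add_sum_update j fun x => if p x then (1 : ℝ) else 0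
  simp only [prU_eq_expU, expU]
  rw [← add_div, this]
  ring

/-- Fixing the coordinate `j` to `false` or to `true` changes `f` with total probability
`Inf_j[f]`. -/
lemma influence_eq_add (f : (ι → Bool) → Bool) (j : ι) :
    influence f j = prU (fun x => f x ≠ f (Function.update x j false)) +
      prU (fun x => f x ≠ f (Function.update x j true)) := by
  rw [influence, prU_eq_expU, prU_eq_expU, prU_eq_expU, ← expU_add]
  congr 1
  funext x
  have hx := Function.update_eq_self j x
  cases h : x j <;> rw [h] at hx <;> simp [hx]

namespace DTree

/-- The number of internal nodes of a decision tree. -/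
def size : DTree ι → ℕ
  | leaf _ => 0
  | node _ t0 t1 => size t0 + size t1 + 1

/-- The tree obtained by answering every query to `j` with the bit `b`. -/
def fixCoord (j : ι) (b : Bool) : DTree ι → DTree ι
  | leaf c => leaf c
  | node k t0 t1 =>
      if k = j then (if b then fixCoord j b t1 else fixCoord j b t0)
      else node k (fixCoord j b t0) (fixCoord j b t1)

lemma size_fixCoord_le {α : Type*} [DecidableEq α] (j : α) (b : Bool) (t : DTree α) :
    (t.fixCoord j b).size ≤ t.size := by
  induction t with
  | leaf c => simp [fixCoord]
  | node k t0 t1 h0 h1 =>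
    simp only [fixCoord]
    split_ifs <;> simp only [size] <;> omega

lemma eval_fixCoord {α : Type*} [DecidableEq α] (j : α) (b : Bool) (t : DTree α) (x : α → Bool) :
    (t.fixCoord j b).eval x = t.eval (Function.update x j b) := by
  induction t with
  | leaf c => simp [fixCoord, eval]
  | node k t0 t1 h0 h1 =>
    by_cases hk : k = j
    · subst hk
      cases b <;> simp_all [fixCoord, eval]
    · simp [fixCoord, eval, hk, h0, h1]

lemma queries_fixCoord {α : Type*} [DecidableEq α] (j : α) (b : Bool) (t : DTree α)
    (x : α → Bool) (i : α) :
    (t.fixCoord j b).Queries x i ↔ i ≠ j ∧ t.Queries (Function.update x j b) i := by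
  induction t with
  | leaf c => simp [fixCoord, Queries]
  | node k t0 t1 h0 h1 =>
    by_cases hk : k = j
    · subst hk
      cases b <;> simp_all [fixCoord, Queries] <;> tauto
    · have hki : k = i → i ≠ j := fun h => h ▸ hk
      by_cases hx : x k = true <;> simp [fixCoord, Queries, hk, h0, h1, hx] <;> tauto

end DTree

lemma deltaU_node (j : ι) (t0 t1 : DTree ι) (i : ι) :
    deltaU (.node j t0 t1) i =
      (deltaU (t0.fixCoord j false) i + deltaU (t1.fixCoord j true) i) / 2 +
        if i = j then 1 else 0 := by
  unfold deltaU
  rw [prU_eq_half_add_half j]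
  by_cases h : i = j
  · subst h
    simp [DTree.queries_fixCoord, DTree.Queries, prU_true, prU_false]
  · simp [DTree.queries_fixCoord, DTree.Queries, h, Ne.symm h]

lemma half_add_sub_influence_le_distU_node (j : ι) (t0 t1 : DTree ι) (f : (ι → Bool) → Bool) :
    (distU (t0.fixCoord j false).eval f + distU (t1.fixCoord j true).eval f) / 2 -
      influence f j / 2 ≤ distU (DTree.node j t0 t1).eval f := by
  have key (b : Bool) (t : DTree ι) : distU (t.fixCoord j b).eval f ≤
      prU (fun x => t.eval (Function.update x j b) ≠ f (Function.update x j b)) +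
        prU (fun x => f x ≠ f (Function.update x j b)) := by
    refine prU_le_add fun x hx => ?_
    rw [DTree.eval_fixCoord] at hx
    by_contra! h
    exact hx (h.1.trans h.2.symm)
  have hT : distU (DTree.node j t0 t1).eval f =
      (prU (fun x => t0.eval (Function.update x j false) ≠ f (Function.update x j false)) +
        prU (fun x => t1.eval (Function.update x j true) ≠ f (Function.update x j true))) / 2 := by
    rw [distU, prU_eq_half_add_half j]
    simp [DTree.eval]
  rw [hT, influence_eq_add]
  linarith [key false t0, key true t1]

/-- The two-function OSSS inequality for a decision tree `T` and a Boolean function `f`. -/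
theorem biasU_le_distU_add (T : DTree ι) (f : (ι → Bool) → Bool) :
    biasU f ≤ distU T.eval f + (∑ i, deltaU T i * influence f i) / 2 := by
  induction h : T.size using Nat.strong_induction_on generalizing T with
  | _ n ih =>
    cases T with
    | leaf b =>
      have hδ (i : ι) : deltaU (.leaf b) i = 0 := prU_false
      have hd : distU (DTree.leaf b).eval f = distU f fun _ => b := by
        simp [distU, DTree.eval, ne_comm]
      rw [hd]
      cases b <;> simp [hδ, biasU]
    | node j t0 t1 =>
      have hn : t0.size + t1.size + 1 = n := h
      have s0 := DTree.size_fixCoord_le j false t0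
      have s1 := DTree.size_fixCoord_le j true t1
      have h0 := ih _ (by omega) (t0.fixCoord j false) rfl
      have h1 := ih _ (by omega) (t1.fixCoord j true) rfl
      have hd := half_add_sub_influence_le_distU_node j t0 t1 f
      have hs : ∑ i, deltaU (.node j t0 t1) i * influence f i =
          (∑ i, deltaU (t0.fixCoord j false) i * influence f i +
            ∑ i, deltaU (t1.fixCoord j true) i * influence f i) / 2 + influence f j := by
        simp only [deltaU_node, add_mul, add_div, Finset.sum_add_distrib, Finset.sum_div]
        congr 1
        · congr 1 <;> refine Finset.sum_congr rfl fun i _ => ?_ <;> ring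
        · simp
      rw [hs]
      linarith

lemma prU_forall_mem_eq_true (S : Finset ι) :
    prU (fun x => ∀ p ∈ S, x p = true) = (1 / 2) ^ S.card := by
  have hset : (Finset.univ.filter fun x : ι → Bool => ∀ p ∈ S, x p = true) =
      Fintype.piFinset fun p => if p ∈ S then {true} else Finset.univ := by
    ext x
    simp only [Finset.mem_filter, Finset.mem_univ, true_and, Fintype.mem_piFinset]
    refine forall_congr' fun p => ?_
    by_cases hp : p ∈ S <;> simp [hp]
  have hprod : ∏ p : ι, (if p ∈ S then (1 / 2 : ℝ) else 1) = (1 / 2) ^ S.card := by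
    simp
  rw [prU_eq_card_div, hset, Fintype.card_piFinset, Fintype.card_pi, Nat.cast_prod, Nat.cast_prod,
    ← Finset.prod_div_distrib, ← hprod]
  refine Finset.prod_congr rfl fun p _ => ?_
  by_cases hp : p ∈ S <;> simp [hp]

lemma influence_tribes_le (w : ℕ) (p : Fin (2 ^ w) × Fin w) :
    influence (tribes w) p ≤ 2 / 2 ^ w := by
  obtain ⟨i, j⟩ := p
  let S : Finset (Fin (2 ^ w) × Fin w) := {i} ×ˢ (Finset.univ.erase j)
  have hS : S.card = w - 1 := by simp [S]
  have hw : w - 1 + 1 = w := by have := j.pos; omega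
  have hle : influence (tribes w) (i, j) ≤ prU (fun x => ∀ p ∈ S, x p = true) := by
    refine prU_mono fun x hx => ?_
    by_contra hS
    apply hx
    simp only [S, Finset.mem_product, Finset.mem_singleton, Finset.mem_erase, Finset.mem_univ,
      and_true] at hS
    push Not at hS
    obtain ⟨⟨i', k⟩, ⟨rfl, hk⟩, hxk⟩ := hS
    simp only at hk hxk
    unfold tribes
    congr 1
    refine propext (exists_congr fun a => ?_)
    by_cases ha : a = i'
    · subst ha
      refine iff_of_false (fun h => hxk (h k)) fun h => hxk ?_
      have := h k
      rwa [Function.update_of_ne (by simpa using hk)] at this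
    · refine forall_congr' fun b => ?_
      rw [Function.update_of_ne (by simp [ha])]
  refine hle.trans_eq ?_
  rw [prU_forall_mem_eq_true, hS]
  nth_rewrite 2 [← hw]
  rw [pow_succ, one_div_pow]
  field_simp

lemma prU_tribes_eq_false (w : ℕ) :
    prU (fun x => tribes w x = false) = (1 - 1 / 2 ^ w) ^ 2 ^ w := by
  have hcard : (Finset.univ.filter fun x => tribes w x = false).card = (2 ^ w - 1) ^ 2 ^ w := by
    have hblock : (Finset.univ.erase fun _ : Fin w => true).card = 2 ^ w - 1 := by simp
    have hpi : (Fintype.piFinset fun _ : Fin (2 ^ w) =>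
        Finset.univ.erase fun _ : Fin w => true).card = (2 ^ w - 1) ^ 2 ^ w := by
      simp [Fintype.card_piFinset, hblock]
    rw [← hpi]
    refine Finset.card_equiv (Equiv.curry _ _ _) fun x => ?_
    simp [tribes, funext_iff, Function.curry]
  have h1 : (1 : ℕ) ≤ 2 ^ w := Nat.one_le_two_pow
  rw [prU_eq_card_div, hcard]
  push_cast [Nat.cast_sub h1]
  simp only [Fintype.card_pi, Fintype.card_bool, Finset.prod_const, Finset.card_univ,
    Fintype.card_prod, Fintype.card_fin]
  push_cast
  rw [mul_comm, pow_mul, ← div_pow, sub_div, div_self (by positivity)]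

lemma quarter_le_one_sub_pow {w : ℕ} (hw : 1 ≤ w) :
    (1 / 4 : ℝ) ≤ (1 - 1 / 2 ^ w) ^ 2 ^ w := by
  induction w, hw using Nat.le_induction with
  | base => norm_num
  | succ n hn ih =>
    have hle : (1 : ℝ) / 2 ^ n ≤ 1 := by
      rw [div_le_one (by positivity)]
      exact one_le_pow₀ (by norm_num)
    have hhalf : (1 : ℝ) / 2 ^ (n + 1) = 1 / 2 ^ n / 2 := by rw [pow_succ, div_div]
    calc (1 / 4 : ℝ) ≤ (1 - 1 / 2 ^ n) ^ 2 ^ n := ih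
      _ ≤ ((1 - 1 / 2 ^ (n + 1)) ^ 2) ^ 2 ^ n := by
        refine pow_le_pow_left₀ (sub_nonneg.2 hle) ?_ _
        rw [hhalf]
        nlinarith [sq_nonneg ((1 : ℝ) / 2 ^ n)]
      _ = (1 - 1 / 2 ^ (n + 1)) ^ 2 ^ (n + 1) := by rw [← pow_mul, ← pow_succ']

lemma one_sub_pow_le (w : ℕ) : (1 - 1 / 2 ^ w : ℝ) ^ 2 ^ w ≤ 3 / 4 := by
  have h := Real.one_sub_div_pow_le_exp_neg (n := 2 ^ w) (t := 1)
    (by exact_mod_cast Nat.one_le_two_pow)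
  push_cast at h
  refine h.trans ?_
  linarith [Real.exp_neg_one_lt_d9]

lemma quarter_le_biasU_tribes {w : ℕ} (hw : 1 ≤ w) : 1 / 4 ≤ biasU (tribes w) := by
  have hf := prU_tribes_eq_false w
  have ht : distU (tribes w) (fun _ => true) = prU (fun x => tribes w x = false) := by
    simp [distU]
  have hc : distU (tribes w) (fun _ => false) = 1 - prU (fun x => tribes w x = false) :=
    prU_compl _
  rw [biasU, ht, hc, hf]
  exact le_min (by linarith [one_sub_pow_le w]) (quarter_le_one_sub_pow hw)

/-- For `w ≥ 1` and `ε₀ ∈ [0, 1/4)`, every decision tree `T` with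
`dist(T, Tribes_w) ≤ ε₀` satisfies `Σ_{i,j} δ_{i,j}(T) ≥ (1/4 − ε₀)·2^w`:
the expected number of queried coordinates is at least `(1/4 − ε₀)·2^w`. -/
theorem tribes_query_lower_bound (w : ℕ) (hw : 1 ≤ w)
    (ε₀ : ℝ) (hε₀ : 0 ≤ ε₀) (hε₁ : ε₀ < 1 / 4)
    (T : DTree (Fin (2 ^ w) × Fin w)) (hT : distU T.eval (tribes w) ≤ ε₀) :
    (1 / 4 - ε₀) * 2 ^ w ≤ ∑ p : Fin (2 ^ w) × Fin w, deltaU T p := by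
  have hbias := quarter_le_biasU_tribes hw
  have hosss := biasU_le_distU_add T (tribes w)
  have hsum : ∑ p, deltaU T p * influence (tribes w) p ≤ (∑ p, deltaU T p) * (2 / 2 ^ w) := by
    rw [Finset.sum_mul]
    refine Finset.sum_le_sum fun p _ => ?_
    exact mul_le_mul_of_nonneg_left (influence_tribes_le w p) (prU_nonneg _)
  rw [← le_div_iff₀ (by positivity)]
  have : (∑ p, deltaU T p) * (2 / 2 ^ w) / 2 = (∑ p, deltaU T p) / 2 ^ w := by ring
  linarith
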